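/- Let N ≥ 0 and define u : ℝ² ∖ {0} → ℝ by u(z) = exp(−|z|^{1+N/2}). Then u satisfies Δu − Vu = 0 on ℝ² ∖ {0}, where V(z) = (1+N/2)² (|z|^{1+N/2} − 1) |z|^{N/2−1}, and |V(z)| ≤ (1+N/2)² |z|^N for all |z| ≥ 1. In particular, there is a nontrivial solution decaying exactly at the rate exp(−|z|^{1+N/2}), so the exponent 1 + N/2 in the decay rate of the main theorem cannot be improved. -/

import Mathlib

/-- The Laplacian of a function `u : ℂ → ℝ`, viewing `ℂ` as `ℝ²`:
`Δu = ∂²u/∂x² + ∂²u/∂y²`. -/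
noncomputable def planeLaplacian (u : ℂ → ℝ) (z : ℂ) : ℝ :=
  fderiv ℝ (fun w => fderiv ℝ u w 1) z 1
    + fderiv ℝ (fun w => fderiv ℝ u w Complex.I) z Complex.I

theorem hasFDerivAt_norm_rpow_of_ne_zero {E : Type*} [NormedAddCommGroup E]
    [InnerProductSpace ℝ E] (p : ℝ) {x : E} (hx : x ≠ 0) :
    HasFDerivAt (fun y : E => ‖y‖ ^ p) ((p * ‖x‖ ^ (p - 2)) • innerSL ℝ x) x := by
  have hsq : HasFDerivAt (fun y : E => ‖y‖ ^ 2) (2 • innerSL ℝ x) x :=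
    (hasStrictFDerivAt_norm_sq x).hasFDerivAt
  have hpow (q : ℝ) (y : E) : (‖y‖ ^ 2) ^ q = ‖y‖ ^ (2 * q) := by
    rw [← Real.rpow_natCast_mul (norm_nonneg y)]
    norm_num
  have h := hsq.rpow_const (p := p / 2) (Or.inl (by positivity))
  simp only [hpow] at h
  convert h using 1
  · simp only [mul_div_cancel₀ p (two_ne_zero' ℝ)]
  · ext v
    simp only [smul_apply, nsmul_eq_mul, smul_eq_mul,
      mul_sub, mul_div_cancel₀ p (two_ne_zero' ℝ), mul_one]
    push_cast
    ring

theorem hasFDerivAt_exp_neg_norm_rpow {E : Type*} [NormedAddCommGroup E]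
    [InnerProductSpace ℝ E] (p : ℝ) {x : E} (hx : x ≠ 0) :
    HasFDerivAt (fun y : E => Real.exp (-‖y‖ ^ p))
      ((-(p * ‖x‖ ^ (p - 2)) * Real.exp (-‖x‖ ^ p)) • innerSL ℝ x) x := by
  convert (hasFDerivAt_norm_rpow_of_ne_zero p hx).fun_neg.exp using 1
  module

theorem fderiv_fderiv_exp_neg_norm_rpow {E : Type*} [NormedAddCommGroup E]
    [InnerProductSpace ℝ E] (p : ℝ) {x : E} (hx : x ≠ 0) (v : E) :
    fderiv ℝ (fun y => fderiv ℝ (fun w : E => Real.exp (-‖w‖ ^ p)) y v) x v =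
      ((p ^ 2 * (‖x‖ ^ (p - 2)) ^ 2 - p * (p - 2) * ‖x‖ ^ (p - 4)) * inner ℝ x v ^ 2
        - p * ‖x‖ ^ (p - 2) * ‖v‖ ^ 2) * Real.exp (-‖x‖ ^ p) := by
  have heq : (fun y => fderiv ℝ (fun w : E => Real.exp (-‖w‖ ^ p)) y v) =ᶠ[nhds x]
      fun y => -p * (‖y‖ ^ (p - 2) * Real.exp (-‖y‖ ^ p) * innerSL ℝ v y) := by
    filter_upwards [isOpen_ne.mem_nhds hx] with y hy
    rw [(hasFDerivAt_exp_neg_norm_rpow p hy).fderiv]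
    simp [real_inner_comm]
    ring
  have hderiv := (((hasFDerivAt_norm_rpow_of_ne_zero (p - 2) hx).mul
    (hasFDerivAt_exp_neg_norm_rpow p hx)).mul (innerSL ℝ v).hasFDerivAt).const_mul (-p)
  have hexp : p - 2 - 2 = p - 4 := by ring
  rw [heq.fderiv_eq]
  refine (congrArg (fun L => L v) hderiv.fderiv).trans ?_
  simp [hexp, real_inner_comm]
  ring

theorem planeLaplacian_exp_neg_norm_rpow (p : ℝ) {z : ℂ} (hz : z ≠ 0) :
    planeLaplacian (fun w => Real.exp (-‖w‖ ^ p)) z =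
      (p ^ 2 * (‖z‖ ^ p - 1) * ‖z‖ ^ (p - 2)) * Real.exp (-‖z‖ ^ p) := by
  have hpos : 0 < ‖z‖ := norm_pos_iff.mpr hz
  have hsq : inner ℝ z 1 ^ 2 + inner ℝ z Complex.I ^ 2 = ‖z‖ ^ 2 := by
    rw [Complex.sq_norm, Complex.normSq_apply]
    simp [Complex.inner]
    ring
  have hmul (q : ℝ) : ‖z‖ ^ (q - 2) * ‖z‖ ^ 2 = ‖z‖ ^ q := by
    rw [← Real.rpow_add_natCast hpos.ne']
    norm_num
  have hp := hmul p
  have hp' := hmul (p - 2)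
  rw [show p - 2 - 2 = p - 4 by ring] at hp'
  rw [planeLaplacian, fderiv_fderiv_exp_neg_norm_rpow p hz, fderiv_fderiv_exp_neg_norm_rpow p hz]
  simp only [norm_one, Complex.norm_I]
  linear_combination Real.exp (-‖z‖ ^ p) *
    ((p ^ 2 * (‖z‖ ^ (p - 2)) ^ 2 - p * (p - 2) * ‖z‖ ^ (p - 4)) * hsq
      + p ^ 2 * ‖z‖ ^ (p - 2) * hp - p * (p - 2) * hp')

theorem abs_rpow_sub_one_mul_rpow_le {p r : ℝ} (hp : 0 ≤ p) (hr : 1 ≤ r) :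
    |p ^ 2 * (r ^ p - 1) * r ^ (p - 2)| ≤ p ^ 2 * r ^ (2 * p - 2) := by
  have hpos : 0 < r := by linarith
  have hone : 0 ≤ r ^ p - 1 := sub_nonneg.mpr (Real.one_le_rpow hr hp)
  rw [abs_of_nonneg (by positivity), show 2 * p - 2 = p + (p - 2) by ring, Real.rpow_add hpos,
    mul_assoc]
  gcongr
  linarith

/-- Sharpness of the main theorem for every `N ≥ 0`: the function
`u(z) = exp(−|z|^{1+N/2})` satisfies `Δu − Vu = 0` on `ℝ² ∖ {0}` with
`V(z) = (1+N/2)²(|z|^{1+N/2} − 1)|z|^{N/2−1}`, and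
`|V(z)| ≤ (1+N/2)²|z|^N` for `|z| ≥ 1`. -/
theorem sharpness_example_decay (N : ℝ) (hN : 0 ≤ N) :
    (∀ z : ℂ, z ≠ 0 →
      planeLaplacian (fun w => Real.exp (-‖w‖ ^ (1 + N / 2))) z
        = ((1 + N / 2) ^ 2 * (‖z‖ ^ (1 + N / 2) - 1) * ‖z‖ ^ (N / 2 - 1))
            * Real.exp (-‖z‖ ^ (1 + N / 2))) ∧
    (∀ z : ℂ, 1 ≤ ‖z‖ →
      |(1 + N / 2) ^ 2 * (‖z‖ ^ (1 + N / 2) - 1) * ‖z‖ ^ (N / 2 - 1)|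
        ≤ (1 + N / 2) ^ 2 * ‖z‖ ^ N) := by
  have hexp : N / 2 - 1 = 1 + N / 2 - 2 := by ring
  have hN' : N = 2 * (1 + N / 2) - 2 := by ring
  refine ⟨fun z hz => ?_, fun z hz => ?_⟩
  · rw [hexp]
    exact planeLaplacian_exp_neg_norm_rpow _ hz
  · have h := abs_rpow_sub_one_mul_rpow_le (p := 1 + N / 2) (by positivity) hz
    rwa [← hexp, ← hN'] at h
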